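/- Let n and N be positive integers, and let Q̂ and S be real positive semidefinite N×N matrices with trace(Q̂) = trace(S) = N, λ_min(S) ≤ λ_min(Q̂), and λ_max(Q̂) ≤ λ_max(S). Then the matrix I + (1/n)·Q̂ is invertible and ‖I − ((n+1)/n)·(I + (1/n)·Q̂)⁻¹·S‖ ≤ ((n+1)/n)²·(λ_max(S) − λ_min(S)). -/

import Mathlib

/-- The operator norm of a real square matrix, i.e. the norm of the induced
linear map on Euclidean space (the supremum of `‖H v‖` over unit vectors `v`). -/
noncomputable def matrixOpNorm {N : ℕ} (H : Matrix (Fin N) (Fin N) ℝ) : ℝ :=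
  ‖Matrix.toEuclideanCLM (𝕜 := ℝ) H‖

open scoped RealInnerProductSpace

namespace Matrix

variable {ι : Type*} [Fintype ι] [DecidableEq ι] {A : Matrix ι ι ℝ}

lemma IsHermitian.isSymmetric_toEuclideanCLM (hA : A.IsHermitian) :
    (toEuclideanCLM (𝕜 := ℝ) A).IsSymmetric := by
  rw [coe_toEuclideanCLM_eq_toEuclideanLin]
  exact isSymmetric_toEuclideanLin_iff.mpr hA

lemma IsHermitian.toEuclideanCLM_eigenvectorBasis (hA : A.IsHermitian) (i : ι) :
    toEuclideanCLM (𝕜 := ℝ) A (hA.eigenvectorBasis i) =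
      hA.eigenvalues i • hA.eigenvectorBasis i :=
  WithLp.ofLp_injective 2 (by simpa using hA.mulVec_eigenvectorBasis i)

lemma IsHermitian.inner_toEuclideanCLM_self (hA : A.IsHermitian) (v : EuclideanSpace ℝ ι) :
    ⟪toEuclideanCLM (𝕜 := ℝ) A v, v⟫ =
      ∑ i, hA.eigenvalues i * ⟪hA.eigenvectorBasis i, v⟫ ^ 2 := by
  rw [← hA.eigenvectorBasis.sum_inner_mul_inner]
  refine Finset.sum_congr rfl fun i _ ↦ ?_
  have h := hA.isSymmetric_toEuclideanCLM v (hA.eigenvectorBasis i)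
  simp only [ContinuousLinearMap.coe_coe] at h
  rw [h, hA.toEuclideanCLM_eigenvectorBasis, real_inner_smul_right,
    real_inner_comm v (hA.eigenvectorBasis i)]
  ring

lemma IsHermitian.iInf_eigenvalues_mul_sq_norm_le (hA : A.IsHermitian)
    (v : EuclideanSpace ℝ ι) :
    (⨅ i, hA.eigenvalues i) * ‖v‖ ^ 2 ≤ ⟪toEuclideanCLM (𝕜 := ℝ) A v, v⟫ := by
  rw [hA.inner_toEuclideanCLM_self, ← hA.eigenvectorBasis.sum_sq_inner_right, Finset.mul_sum]
  gcongr with i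
  exact ciInf_le (Set.finite_range _).bddBelow i

lemma IsHermitian.inner_le_iSup_eigenvalues_mul_sq_norm (hA : A.IsHermitian)
    (v : EuclideanSpace ℝ ι) :
    ⟪toEuclideanCLM (𝕜 := ℝ) A v, v⟫ ≤ (⨆ i, hA.eigenvalues i) * ‖v‖ ^ 2 := by
  rw [hA.inner_toEuclideanCLM_self, ← hA.eigenvectorBasis.sum_sq_inner_right, Finset.mul_sum]
  gcongr with i
  exact le_ciSup (Set.finite_range _).bddAbove i

lemma IsHermitian.card_mul_iInf_eigenvalues_le_trace (hA : A.IsHermitian) :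
    Fintype.card ι * (⨅ i, hA.eigenvalues i) ≤ A.trace := by
  rw [hA.trace_eq_sum_eigenvalues, ← nsmul_eq_mul]
  exact Finset.card_nsmul_le_sum _ _ _ fun i _ ↦ ciInf_le (Set.finite_range _).bddBelow i

lemma IsHermitian.trace_le_card_mul_iSup_eigenvalues (hA : A.IsHermitian) :
    A.trace ≤ Fintype.card ι * ⨆ i, hA.eigenvalues i := by
  rw [hA.trace_eq_sum_eigenvalues, ← nsmul_eq_mul]
  exact Finset.sum_le_card_nsmul _ _ _ fun i _ ↦
    le_ciSup (f := hA.eigenvalues) (Set.finite_range _).bddAbove i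

lemma norm_toEuclideanCLM_inv_le_one (hA : IsUnit A)
    (h : ∀ v : EuclideanSpace ℝ ι, ‖v‖ ^ 2 ≤ ⟪toEuclideanCLM (𝕜 := ℝ) A v, v⟫) :
    ‖toEuclideanCLM (𝕜 := ℝ) A⁻¹‖ ≤ 1 := by
  refine ContinuousLinearMap.opNorm_le_bound _ zero_le_one fun v ↦ ?_
  set w := toEuclideanCLM (𝕜 := ℝ) A⁻¹ v
  have hw : toEuclideanCLM (𝕜 := ℝ) A w = v := by
    rw [← mul_apply_eq_comp, ← map_mul,
      A.mul_nonsing_inv ((isUnit_iff_isUnit_det A).mp hA)]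
    simp
  have h₁ := h w
  rw [hw] at h₁
  have h₂ := real_inner_le_norm v w
  by_contra! hlt
  nlinarith [norm_nonneg v, norm_nonneg w]

end Matrix

lemma ContinuousLinearMap.norm_le_of_abs_inner_self_le {E : Type*} [NormedAddCommGroup E]
    [InnerProductSpace ℝ E] {T : E →L[ℝ] E} (hT : T.IsSymmetric) {K : ℝ} (hK : 0 ≤ K)
    (h : ∀ v, |⟪T v, v⟫| ≤ K * ‖v‖ ^ 2) : ‖T‖ ≤ K := by
  rw [T.norm_eq_iSup_rayleighQuotient hT]
  refine ciSup_le fun v ↦ ?_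
  rw [rayleighQuotient, abs_div, abs_sq]
  exact div_le_of_le_mul₀ (sq_nonneg _) hK (h v)

/-- If `Q̂` and `S` are real positive semidefinite with trace `N`,
`λ_min(S) ≤ λ_min(Q̂)` and `λ_max(Q̂) ≤ λ_max(S)`, then `I + (1/n) • Q̂` is
invertible and
`‖I − ((n+1)/n) (I + (1/n) Q̂)⁻¹ S‖ ≤ ((n+1)/n)² (λ_max(S) − λ_min(S))`. -/
theorem norm_estimate_eigenval (n N : ℕ) (hn : 0 < n) (hN : 0 < N)
    (Qhat S : Matrix (Fin N) (Fin N) ℝ)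
    (hQhat : Qhat.PosSemidef) (hS : S.PosSemidef)
    (htrQ : Qhat.trace = N) (htrS : S.trace = N)
    (hmin : (⨅ i, hS.isHermitian.eigenvalues i) ≤ ⨅ i, hQhat.isHermitian.eigenvalues i)
    (hmax : (⨆ i, hQhat.isHermitian.eigenvalues i) ≤ ⨆ i, hS.isHermitian.eigenvalues i) :
    IsUnit (1 + ((n : ℝ))⁻¹ • Qhat) ∧
      matrixOpNorm (1 - ((n + 1 : ℝ) / n) • ((1 + ((n : ℝ))⁻¹ • Qhat)⁻¹ * S)) ≤
        ((n + 1 : ℝ) / n) ^ 2 *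
          ((⨆ i, hS.isHermitian.eigenvalues i) - ⨅ i, hS.isHermitian.eigenvalues i) := by
  have : Nonempty (Fin N) := ⟨⟨0, hN⟩⟩
  have hN' : (0 : ℝ) < N := by exact_mod_cast hN
  have hn' : (0 : ℝ) < (n : ℝ)⁻¹ := by positivity
  have hc : (n + 1 : ℝ) / n = 1 + (n : ℝ)⁻¹ := by field_simp
  have hS_inf := hS.isHermitian.card_mul_iInf_eigenvalues_le_trace
  have hS_sup := hS.isHermitian.trace_le_card_mul_iSup_eigenvalues
  have hS_lower := hS.isHermitian.iInf_eigenvalues_mul_sq_norm_le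
  have hS_upper := hS.isHermitian.inner_le_iSup_eigenvalues_mul_sq_norm
  have hQ_lower := hQhat.isHermitian.iInf_eigenvalues_mul_sq_norm_le
  have hQ_upper := hQhat.isHermitian.inner_le_iSup_eigenvalues_mul_sq_norm
  have hQ_nonneg : 0 ≤ ⨅ i, hQhat.isHermitian.eigenvalues i :=
    le_ciInf hQhat.eigenvalues_nonneg
  rw [hc]
  set t := (n : ℝ)⁻¹
  set m := ⨅ i, hS.isHermitian.eigenvalues i
  set M := ⨆ i, hS.isHermitian.eigenvalues i
  set A : Matrix (Fin N) (Fin N) ℝ := 1 + t • Qhat with hA_def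
  have hm : m ≤ 1 := by
    rw [htrS, Fintype.card_fin] at hS_inf
    nlinarith
  have hM : 1 ≤ M := by
    rw [htrS, Fintype.card_fin] at hS_sup
    nlinarith
  have hA : IsUnit A := (Matrix.PosDef.one.add_posSemidef (hQhat.smul hn'.le)).isUnit
  refine ⟨hA, ?_⟩
  have hfactor : 1 - (1 + t) • (A⁻¹ * S) = A⁻¹ * (A - (1 + t) • S) := by
    rw [mul_sub, A.nonsing_inv_mul ((Matrix.isUnit_iff_isUnit_det A).mp hA), mul_smul_comm]
  have hinv : ‖Matrix.toEuclideanCLM (𝕜 := ℝ) A⁻¹‖ ≤ 1 := by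
    refine Matrix.norm_toEuclideanCLM_inv_le_one hA fun v ↦ ?_
    simp only [hA_def, map_add, map_one, map_smul, add_apply,
      one_apply_eq_self, smul_apply, inner_add_left,
      real_inner_smul_left, real_inner_self_eq_norm_sq]
    have := (mul_nonneg hQ_nonneg (sq_nonneg ‖v‖)).trans (hQ_lower v)
    nlinarith
  have hdiff_herm : (A - (1 + t) • S).IsHermitian :=
    (Matrix.isHermitian_one.add (hQhat.smul hn'.le).isHermitian).sub
      (hS.smul (by positivity : 0 ≤ 1 + t)).isHermitian
  have hdiff : ‖Matrix.toEuclideanCLM (𝕜 := ℝ) (A - (1 + t) • S)‖ ≤ (1 + t) * (M - m) := by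
    refine ContinuousLinearMap.norm_le_of_abs_inner_self_le
      hdiff_herm.isSymmetric_toEuclideanCLM (mul_nonneg (by positivity) (by linarith)) fun v ↦ ?_
    simp only [hA_def, map_sub, map_add, map_one, map_smul, add_apply,
      sub_apply, one_apply_eq_self,
      smul_apply, inner_add_left, inner_sub_left,
      real_inner_smul_left, real_inner_self_eq_norm_sq]
    have hv := sq_nonneg ‖v‖
    have hQ₁ := mul_le_mul_of_nonneg_left
      ((mul_le_mul_of_nonneg_right hmin hv).trans (hQ_lower v)) hn'.le
    have hQ₂ := mul_le_mul_of_nonneg_left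
      ((hQ_upper v).trans (mul_le_mul_of_nonneg_right hmax hv)) hn'.le
    have ht : 0 ≤ 1 + t := by positivity
    have hS₁ := mul_le_mul_of_nonneg_left (hS_lower v) ht
    have hS₂ := mul_le_mul_of_nonneg_left (hS_upper v) ht
    have hm' := mul_le_mul_of_nonneg_right hm hv
    have hM' := mul_le_mul_of_nonneg_right hM hv
    rw [abs_le]
    constructor <;> linarith
  rw [matrixOpNorm, hfactor, map_mul]
  calc _ ≤ 1 * ((1 + t) * (M - m)) :=
        (norm_mul_le _ _).trans (mul_le_mul hinv hdiff (norm_nonneg _) zero_le_one)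
    _ ≤ (1 + t) ^ 2 * (M - m) := by
        nlinarith [mul_nonneg (mul_nonneg hn'.le (by positivity : 0 ≤ 1 + t))
          (by linarith : 0 ≤ M - m)]
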